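/- Let A be a unital C*-algebra with a normalized trace τ, let B be a commutative unital C*-algebra, and let ι : B → A be a unital *-homomorphism. Suppose μ is a diffuse regular Borel probability measure on the character space of B such that τ(ι(b)) = ∫ b̂ dμ for every b ∈ B, where b̂ denotes the Gelfand transform of b. Then there exists a unitary element u of A lying in the image of ι such that τ(uⁿ) = 0 for every integer n ≠ 0; in particular the powers {uⁿ}_{n ∈ ℤ} form an orthonormal set for the inner product ⟨a,b⟩ = τ(b*a) on A. -/

import Mathlib

open MeasureTheory WeakDual
open scoped ComplexOrder

section DiffuseMeasure

open Filter Topology Set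

variable {X : Type*} [TopologicalSpace X] [CompactSpace X] [T2Space X]
  [MeasurableSpace X]

/-- The joint fibres of suitable finitely many continuous functions have small measure. -/
lemma exists_finite_fibers_small (μ : Measure X) [μ.OuterRegular] (hμ : ∀ x, μ {x} = 0)
    {ε : ENNReal} (hε : 0 < ε) :
    ∃ S : Set C(X, ℝ), S.Finite ∧ (∀ f ∈ S, ∀ x, f x ∈ Icc (0 : ℝ) 1) ∧
      ∀ x, μ {y | ∀ f ∈ S, f y = f x} ≤ ε := by
  have key : ∀ x : X, ∃ f : C(X, ℝ), f x = 1 ∧ (∀ y, f y ∈ Icc (0 : ℝ) 1) ∧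
      μ {y | f y ≠ 0} ≤ ε := by
    intro x
    obtain ⟨V, hxV, hV, hVε⟩ := ({x} : Set X).exists_isOpen_lt_of_lt (μ := μ) ε (by rwa [hμ x])
    obtain ⟨f, hf0, hf1, hf⟩ := exists_continuous_zero_one_of_isClosed hV.isClosed_compl
      (isClosed_singleton (x := x)) (disjoint_compl_left_iff_subset.2 hxV)
    refine ⟨f, hf1 rfl, hf, (measure_mono fun y hy => ?_).trans hVε.le⟩
    by_contra hyV
    exact hy (hf0 hyV)
  choose F hF1 hF hFε using key
  obtain ⟨t, ht⟩ := isCompact_univ.elim_finite_subcover (fun x => {y | F x y ≠ 0})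
    (fun x => isOpen_ne_fun (F x).continuous continuous_const)
    (fun x _ => mem_iUnion.2 ⟨x, by simp [hF1]⟩)
  refine ⟨F '' t, t.finite_toSet.image F, ?_, fun x => ?_⟩
  · rintro _ ⟨x, -, rfl⟩
    exact hF x
  · obtain ⟨z, hz, hzx⟩ := mem_iUnion₂.1 (ht (mem_univ x))
    refine (measure_mono fun y hy => ?_).trans (hFε z)
    have := hy (F z) (mem_image_of_mem F hz)
    simpa [this] using hzx

/-- The joint fibres of a suitable sequence of continuous functions are null. -/
lemma exists_seq_fibers_null (μ : Measure X) [μ.OuterRegular] (hμ : ∀ x, μ {x} = 0) :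
    ∃ h : ℕ → C(X, ℝ), (∀ n x, h n x ∈ Icc (0 : ℝ) 1) ∧
      ∀ x, μ {y | ∀ n, h n y = h n x} = 0 := by
  choose S hSfin hS hSε using fun m : ℕ =>
    exists_finite_fibers_small μ hμ (ε := (m : ENNReal)⁻¹) (by simp)
  obtain ⟨h, hh⟩ := ((countable_iUnion fun m => (hSfin m).countable).insert
    (0 : C(X, ℝ))).exists_eq_range (insert_nonempty _ _)
  refine ⟨h, fun n x => ?_, fun x => ?_⟩
  · have : h n ∈ insert 0 (⋃ m, S m) := hh ▸ mem_range_self n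
    rcases this with h0 | hn
    · simp [h0]
    · obtain ⟨m, hm⟩ := mem_iUnion.1 hn
      exact hS m _ hm x
  · refine le_antisymm (ge_of_tendsto' ENNReal.tendsto_inv_nat_nhds_zero fun m => ?_) bot_le
    refine (measure_mono fun y hy f hf => ?_).trans (hSε m x)
    have : f ∈ range h := hh ▸ mem_insert_of_mem _ (mem_iUnion.2 ⟨m, hf⟩)
    obtain ⟨n, rfl⟩ := this
    exact hy n

lemma abs_pow_div_factorial_mul_le (c : ℝ) {d : ℝ} (hd : |d| ≤ 1) (n : ℕ) :
    ‖c ^ n / n.factorial * d‖ ≤ |c| ^ n / n.factorial := by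
  rw [norm_mul, norm_div, norm_pow, Real.norm_eq_abs, Real.norm_eq_abs, Nat.abs_cast,
    Real.norm_eq_abs]
  exact mul_le_of_le_one_right (by positivity) hd

lemma summable_pow_div_factorial_mul (c : ℝ) {d : ℕ → ℝ} (hd : ∀ n, |d n| ≤ 1) :
    Summable fun n => c ^ n / n.factorial * d n :=
  .of_norm_bounded (Real.summable_pow_div_factorial |c|)
    fun n => abs_pow_div_factorial_mul_le c (hd n) n

/-- A nonzero exponential generating function with bounded coefficients is almost everywhere
nonzero. -/
lemma ae_tsum_pow_div_factorial_ne_zero {d : ℕ → ℝ} (hd : ∀ n, |d n| ≤ 1) (hne : ∃ n, d n ≠ 0) :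
    ∀ᵐ c : ℝ, ∑' n : ℕ, c ^ n / n.factorial * d n ≠ 0 := by
  set p := FormalMultilinearSeries.ofScalars ℝ fun n => d n / (n.factorial : ℝ) with hp
  have hrad : p.radius = ⊤ := by
    refine p.radius_eq_top_of_summable_norm fun r =>
      (summable_pow_div_factorial_mul (r : ℝ) hd).norm.congr fun n => ?_
    rw [hp, FormalMultilinearSeries.ofScalars_norm]
    simp only [norm_mul, norm_div, norm_pow, NNReal.norm_eq]
    ring
  have hsum : p.sum = fun c : ℝ => ∑' n : ℕ, c ^ n / n.factorial * d n := by
    funext c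
    refine (FormalMultilinearSeries.ofScalars_sum_eq _ c).trans (tsum_congr fun n => ?_)
    rw [smul_eq_mul]
    ring
  have hps : HasFPowerSeriesOnBall p.sum p 0 ⊤ := hrad ▸ p.hasFPowerSeriesOnBall (by simp [hrad])
  have han : AnalyticOnNhd ℝ p.sum univ := fun x _ => hps.analyticAt_of_mem (by simp)
  suffices h : ∀ᵐ c : ℝ, p.sum c ≠ 0 by simpa only [hsum] using h
  rcases han.eqOn_zero_or_eventually_ne_zero_of_preconnected isPreconnected_univ with h0 | h0
  · obtain ⟨n, hn⟩ := hne
    have hz : p = 0 := hps.hasFPowerSeriesAt.eq_zero_of_eventually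
      (Eventually.of_forall fun x => h0 (mem_univ x))
    have := congrFun ((FormalMultilinearSeries.ofScalars_series_eq_zero ℝ).1 hz) n
    simp [hn, Nat.factorial_ne_zero] at this
  · have := ae_restrict_le_codiscreteWithin (μ := volume) MeasurableSet.univ h0
    rwa [Measure.restrict_univ] at this

/-- A diffuse outer regular finite measure on a compact Hausdorff space has a diffuse image under
some continuous real function. -/
lemma exists_continuous_fibers_null [BorelSpace X] (μ : Measure X) [IsFiniteMeasure μ] [μ.OuterRegular]
    (hμ : ∀ x, μ {x} = 0) : ∃ f : C(X, ℝ), ∀ t, μ (f ⁻¹' {t}) = 0 := by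
  obtain ⟨h, hh, hnull⟩ := exists_seq_fibers_null μ hμ
  have hd : ∀ x y n, |h n y - h n x| ≤ 1 := fun x y n => by
    have := hh n x; have := hh n y
    simp only [mem_Icc] at *
    rw [abs_le]; constructor <;> linarith
  have hd' : ∀ x n, |h n x| ≤ 1 := fun x n => by
    rw [abs_of_nonneg (hh n x).1]; exact (hh n x).2
  let G : (X × X) → ℝ → ℝ := fun p c => ∑' n : ℕ, c ^ n / n.factorial * (h n p.2 - h n p.1)
  have hG : Measurable fun q : (X × X) × ℝ => G q.1 q.2 := by
    refine measurable_of_tendsto_metrizable (f := fun N (q : (X × X) × ℝ) =>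
      ∑ n ∈ Finset.range N, q.2 ^ n / n.factorial * (h n q.1.2 - h n q.1.1)) (fun N => ?_)
      (tendsto_pi_nhds.2 fun q =>
        (summable_pow_div_factorial_mul q.2 (hd q.1.1 q.1.2)).hasSum.tendsto_sum_nat)
    have hm : ∀ n, Measurable (h n) := fun n => (h n).continuous.measurable
    fun_prop
  have hae : ∀ᵐ p ∂μ.prod μ, ∀ᵐ c : ℝ, G p c ≠ 0 := by
    have hmeas : MeasurableSet {p : X × X | ∃ n, h n p.2 ≠ h n p.1} := by
      simp only [ofPred_exists]
      refine .iUnion fun n => (measurableSet_eq_fun ?_ ?_).compl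
      · exact (h n).continuous.measurable.comp measurable_snd
      · exact (h n).continuous.measurable.comp measurable_fst
    have : ∀ᵐ p ∂μ.prod μ, ∃ n, h n p.2 ≠ h n p.1 := by
      rw [Measure.ae_prod_iff_ae_ae hmeas]
      refine Eventually.of_forall fun x => ?_
      rw [ae_iff]
      simpa using hnull x
    filter_upwards [this] with p hp
    refine ae_tsum_pow_div_factorial_ne_zero (hd p.1 p.2) ?_
    simpa [sub_eq_zero] using hp
  rw [Measure.ae_ae_comm (p := fun p c => G p c ≠ 0)
    (measurableSet_eq_fun hG measurable_const).compl] at hae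
  obtain ⟨c, hc⟩ := hae.exists
  refine ⟨⟨fun x => ∑' n : ℕ, c ^ n / n.factorial * h n x,
    continuous_tsum (fun n => by fun_prop) (Real.summable_pow_div_factorial |c|)
      fun n x => abs_pow_div_factorial_mul_le c (hd' x n) n⟩, fun t => ?_⟩
  by_contra ht
  obtain ⟨x, hxt, hx⟩ := ((frequently_ae_iff.2 ht).and_eventually
    (Measure.ae_ae_of_ae_prod hc)).exists
  refine ht (measure_mono_null (fun y hy => ?_) (ae_iff.1 hx))
  simp only [ContinuousMap.coe_mk, mem_preimage, mem_singleton_iff, mem_ofPred_eq, not_not, G,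
    mul_sub] at hxt hy ⊢
  rw [Summable.tsum_sub (summable_pow_div_factorial_mul c (hd' y))
    (summable_pow_div_factorial_mul c (hd' x))]
  exact sub_eq_zero.2 (hy.trans hxt.symm)

end DiffuseMeasure

section ProbabilityIntegralTransform

open Filter Topology Set ProbabilityTheory

lemma continuous_cdf (ν : Measure ℝ) [IsProbabilityMeasure ν] [NullSingletonClass ν] :
    Continuous (cdf ν) := by
  refine continuous_iff_continuousAt.2 fun x => ?_
  rw [(monotone_cdf ν).continuousAt_iff_leftLim_eq_rightLim, StieltjesFunction.rightLim_eq]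
  have h : (cdf ν).measure {x} = 0 := by rw [measure_cdf]; exact measure_singleton x
  rw [StieltjesFunction.measure_singleton, ENNReal.ofReal_eq_zero] at h
  exact le_antisymm ((monotone_cdf ν).leftLim_le le_rfl) (by linarith)

/-- The probability integral transform: the distribution function of a diffuse probability
measure pushes the measure forward to the uniform distribution. -/
lemma map_cdf_eq_restrict_volume (ν : Measure ℝ) [IsProbabilityMeasure ν] [NullSingletonClass ν] :
    ν.map (cdf ν) = volume.restrict (Ioc 0 1) := by
  have hcont := continuous_cdf ν
  have : IsProbabilityMeasure (ν.map (cdf ν)) :=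
    Measure.isProbabilityMeasure_map hcont.aemeasurable
  refine Measure.ext_of_Iic _ _ fun t => ?_
  rw [Measure.map_apply hcont.measurable measurableSet_Iic,
    Measure.restrict_apply measurableSet_Iic, inter_comm, Ioc_inter_Iic, Real.volume_Ioc, sub_zero]
  rcases le_or_gt 1 t with h1 | h1
  · have : cdf ν ⁻¹' Iic t = univ := eq_univ_of_forall fun x => (cdf_le_one ν x).trans h1
    simp [this, h1]
  rw [min_eq_right h1.le]
  have hIic : ∀ s, cdf ν s ≤ t → ν (Iic s) ≤ ENNReal.ofReal t := fun s hs => by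
    rw [← ofReal_cdf]; exact ENNReal.ofReal_le_ofReal hs
  rcases (cdf ν ⁻¹' Iic t).eq_empty_or_nonempty with he | hne
  · rw [he, measure_empty, eq_comm, ENNReal.ofReal_eq_zero]
    by_contra! ht
    obtain ⟨s, hs⟩ := ((tendsto_cdf_atBot ν).eventually_lt_const ht).exists
    exact (he ▸ (show s ∈ cdf ν ⁻¹' Iic t from hs.le) : s ∈ (∅ : Set ℝ))
  obtain ⟨b, hb⟩ := ((tendsto_cdf_atTop ν).eventually_const_lt h1).exists
  have hbdd : BddAbove (cdf ν ⁻¹' Iic t) :=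
    ⟨b, fun s hs => le_of_not_gt fun hbs => (hb.trans_le (monotone_cdf ν hbs.le)).not_ge hs⟩
  have hmem : cdf ν (sSup (cdf ν ⁻¹' Iic t)) ≤ t :=
    (isClosed_Iic.preimage hcont).csSup_mem hne hbdd
  set s := sSup (cdf ν ⁻¹' Iic t)
  have hset : cdf ν ⁻¹' Iic t = Iic s :=
    Subset.antisymm (fun x hx => le_csSup hbdd hx) fun x hx => (monotone_cdf ν hx).trans hmem
  have hst : cdf ν s = t := by
    obtain ⟨x, hx⟩ := mem_range_of_exists_le_of_exists_ge hcont ⟨s, hmem⟩ ⟨b, hb.le⟩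
    exact le_antisymm hmem (hx ▸ monotone_cdf ν (le_csSup hbdd (show cdf ν x ≤ t from hx.le)))
  rw [hset, ← ofReal_cdf, hst]

end ProbabilityIntegralTransform

lemma integral_exp_two_pi_int_mul_eq_zero {n : ℤ} (hn : n ≠ 0) :
    ∫ t in (0 : ℝ)..1, Complex.exp (n * (2 * Real.pi * Complex.I * t)) = 0 := by
  have hc : (n * (2 * Real.pi * Complex.I) : ℂ) ≠ 0 :=
    mul_ne_zero (by exact_mod_cast hn) Complex.two_pi_I_ne_zero
  simp_rw [← mul_assoc (n : ℂ) _ ((_ : ℝ) : ℂ)]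
  rw [integral_exp_mul_complex hc]
  simp [Complex.exp_int_mul_two_pi_mul_I]

/-- A diffuse regular probability measure on a compact Hausdorff space admits a continuous
angle function that is uniformly distributed. -/
lemma exists_continuous_integral_exp_eq_zero {X : Type*} [TopologicalSpace X] [CompactSpace X]
    [T2Space X] [MeasurableSpace X] [BorelSpace X] (μ : Measure X) [IsProbabilityMeasure μ]
    [μ.OuterRegular] (hμ : ∀ x, μ {x} = 0) :
    ∃ θ : C(X, ℝ), ∀ n : ℤ, n ≠ 0 →
      ∫ x, Complex.exp (n * (2 * Real.pi * Complex.I * θ x)) ∂μ = 0 := by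
  obtain ⟨f, hf⟩ := exists_continuous_fibers_null μ hμ
  have hfm : Measurable f := f.continuous.measurable
  have : IsProbabilityMeasure (μ.map f) := Measure.isProbabilityMeasure_map hfm.aemeasurable
  have : NullSingletonClass (μ.map f) :=
    ⟨fun t => by rw [Measure.map_apply hfm (measurableSet_singleton t), hf]⟩
  have hcont := continuous_cdf (μ.map f)
  refine ⟨⟨fun x => ProbabilityTheory.cdf (μ.map f) (f x), hcont.comp f.continuous⟩,
    fun n hn => ?_⟩
  have hexp : Continuous fun t : ℝ => Complex.exp (n * (2 * Real.pi * Complex.I * t)) := by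
    fun_prop
  rw [← integral_exp_two_pi_int_mul_eq_zero hn, intervalIntegral.integral_of_le zero_le_one,
    ← map_cdf_eq_restrict_volume (μ.map f),
    integral_map hcont.aemeasurable hexp.aestronglyMeasurable,
    integral_map hfm.aemeasurable (Continuous.aestronglyMeasurable (by fun_prop))]
  rfl

/-- The unitary `exp (2πiθ)` of `C(X, ℂ)`. -/
noncomputable def expUnitary {X : Type*} [TopologicalSpace X] (θ : C(X, ℝ)) :
    unitary C(X, ℂ) :=
  ⟨⟨fun x => Complex.exp (2 * Real.pi * Complex.I * θ x), by fun_prop⟩, by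
    rw [Unitary.mem_iff_self_mul_star]
    ext x
    simp [← Complex.exp_conj, ← Complex.exp_add, Complex.conj_ofNat]⟩

lemma expUnitary_zpow_apply {X : Type*} [TopologicalSpace X] (θ : C(X, ℝ)) (n : ℤ) (x : X) :
    ((expUnitary θ ^ n : unitary C(X, ℂ)) : C(X, ℂ)) x =
      Complex.exp (n * (2 * Real.pi * Complex.I * θ x)) := by
  rcases n with n | n
  · simp [expUnitary, Complex.exp_nat_mul]
  · rw [zpow_negSucc, ← Unitary.star_eq_inv, Unitary.coe_star, SubmonoidClass.coe_pow,
      Int.cast_negSucc, neg_mul, Complex.exp_neg, Complex.exp_nat_mul, ContinuousMap.star_apply,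
      ContinuousMap.pow_apply, star_pow, ← inv_pow]
    simp [expUnitary, ← Complex.exp_conj, ← Complex.exp_neg, Complex.conj_ofNat]

/-- If a unital C*-algebra `A` with normalized trace `τ` contains (via a unital
*-homomorphism `ι`) a commutative unital C*-algebra `B` such that the measure on the
character space of `B` representing `τ ∘ ι` is diffuse, then `A` contains a unitary `u`
in the image of `ι` (a Haar unitary) with `τ(uⁿ) = 0` for every integer `n ≠ 0`. -/
theorem exists_haar_unitary_of_diffuse
    (A : Type*) [NormedRing A] [StarRing A] [CStarRing A] [CompleteSpace A]
    [NormedAlgebra ℂ A] [StarModule ℂ A]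
    (B : Type*) [NormedCommRing B] [StarRing B] [CStarRing B] [CompleteSpace B]
    [NormedAlgebra ℂ B] [StarModule ℂ B]
    [MeasurableSpace (characterSpace ℂ B)] [BorelSpace (characterSpace ℂ B)]
    (τ : A →ₗ[ℂ] ℂ) (hτ1 : τ 1 = 1)
    (hpos : ∀ a : A, 0 ≤ τ (star a * a))
    (htrace : ∀ a b : A, τ (a * b) = τ (b * a))
    (ι : B →⋆ₐ[ℂ] A)
    (μ : Measure (characterSpace ℂ B)) [IsProbabilityMeasure μ] [μ.Regular]
    (hdiffuse : ∀ χ : characterSpace ℂ B, μ {χ} = 0)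
    (hcompat : ∀ b : B, τ (ι b) = ∫ χ : characterSpace ℂ B, χ b ∂μ) :
    ∃ u : unitary A, (u : A) ∈ Set.range ι ∧
      ∀ n : ℤ, n ≠ 0 → τ ((u ^ n : unitary A) : A) = 0 := by
  let : CommCStarAlgebra B := {}
  obtain ⟨θ, hθ⟩ := exists_continuous_integral_exp_eq_zero μ hdiffuse
  let φ : C(characterSpace ℂ B, ℂ) →⋆ₐ[ℂ] A := ι.comp (gelfandStarTransform B).symm
  refine ⟨Unitary.map ⟨(φ : C(characterSpace ℂ B, ℂ) →* A), map_star φ⟩ (expUnitary θ), ⟨_, rfl⟩, fun n hn => ?_⟩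
  rw [← map_zpow]
  refine (hcompat _).trans (Eq.trans (integral_congr_ae (.of_forall fun χ => ?_)) (hθ n hn))
  refine Eq.trans ?_ (expUnitary_zpow_apply θ n χ)
  exact DFunLike.congr_fun ((gelfandStarTransform B).apply_symm_apply _) χ
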